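/- Let ω = (1,2,...,n,-1,-2,...,-n) ∈ W_n and suppose σ ≤ τ ≤ ω in the partial order coming from (W_n, R_n). Then every orbit of σ is contained in an orbit of τ; in particular, every fixed point of τ is a fixed point of σ. -/

import Mathlib

open scoped Classical

namespace NCPB

/-- A collection of subsets of `α` is a partition: blocks are nonempty and
every element lies in exactly one block. -/
def IsPartition {α : Type*} (P : Set (Set α)) : Prop :=
  (∀ B ∈ P, B.Nonempty) ∧ ∀ a : α, ∃! B, B ∈ P ∧ a ∈ B

/-- The non-crossing condition for a collection of subsets of a linear order:
if `a < b < c < d`, `a, c` lie in a block `B` and `b, d` lie in a block `C`,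
then `b ∈ B` (i.e. the blocks coincide). -/
def IsNC {α : Type*} [LinearOrder α] (P : Set (Set α)) : Prop :=
  ∀ B ∈ P, ∀ C ∈ P, ∀ a b c d : α, a < b → b < c → c < d →
    a ∈ B → c ∈ B → b ∈ C → d ∈ C → b ∈ B

/-- A non-crossing partition of a linear order. -/
def NCPart {α : Type*} [LinearOrder α] (P : Set (Set α)) : Prop :=
  IsPartition P ∧ IsNC P

/-- The set `[±m] = {1 < 2 < ... < m < -1 < -2 < ... < -m}` is encoded as `Fin (2*m)`,
position `k < m` encoding `k+1` and position `m + j` encoding `-(j+1)`.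
`negMap` is the inversion map `a ↦ -a`. -/
def negMap (m : ℕ) (k : Fin (2*m)) : Fin (2*m) :=
  ⟨(k.val + m) % (2*m), Nat.mod_lt _ (Nat.lt_of_le_of_lt (Nat.zero_le _) k.isLt)⟩

/-- Image of a subset of `[±m]` under the inversion map, i.e. `X ↦ -X`. -/
def negSet (m : ℕ) (X : Set (Fin (2*m))) : Set (Fin (2*m)) := negMap m '' X

/-- The absolute value map `[±m] → {1,...,m}`, `±i ↦ i`. -/
def absMap (m : ℕ) (k : Fin (2*m)) : Fin m :=
  ⟨k.val % m, Nat.mod_lt _ (by have := k.isLt; omega)⟩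

/-- A non-crossing partition of type B: a non-crossing partition of `[±m]`
invariant under the inversion map. -/
def NCBPart (m : ℕ) (π : Set (Set (Fin (2*m)))) : Prop :=
  NCPart π ∧ ∀ B ∈ π, negSet m B ∈ π

/-- The collection of sets `Abs(X)`, `X` a block of `π`. -/
def absPart (m : ℕ) (π : Set (Set (Fin (2*m)))) : Set (Set (Fin m)) :=
  {F | ∃ X ∈ π, F = absMap m '' X}

/-- The embedding of `{1,...,m}` onto the odd-indexed positions of the interleaved
set `1 < 1̄ < 2 < 2̄ < ... < m < m̄` (encoded as `Fin (2*m)`): `i ↦ i` (even positions). -/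
def evens (m : ℕ) (i : Fin m) : Fin (2*m) := ⟨2*i.val, by have := i.isLt; omega⟩

/-- The embedding of the barred copy `{1̄,...,m̄}` into the interleaved set: odd positions. -/
def odds (m : ℕ) (i : Fin m) : Fin (2*m) := ⟨2*i.val+1, by have := i.isLt; omega⟩

/-- `P` refines... rather: every block of `P` is contained in a block of `Q`
(the partial order on partitions by reverse refinement: `P ≤ Q`). -/
def Refines {α : Type*} (P Q : Set (Set α)) : Prop := ∀ B ∈ P, ∃ C ∈ Q, B ⊆ C

/-- The collection `p ∪ q̄` of subsets of the interleaved set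
`1 < 1̄ < 2 < 2̄ < ... < m < m̄`, with `p` living on the unbarred copy and `q` on the
barred copy. -/
def interleave (m : ℕ) (p q : Set (Set (Fin m))) : Set (Set (Fin (2*m))) :=
  ((fun B => evens m '' B) '' p) ∪ ((fun B => odds m '' B) '' q)

/-- `q` is the Kreweras complement of `p`: `q` is the largest non-crossing partition
(in the reverse-refinement order) such that `p ∪ q̄` is a non-crossing partition of the
interleaved set `1 < 1̄ < ... < m < m̄`. -/
def IsKr (m : ℕ) (p q : Set (Set (Fin m))) : Prop :=
  NCPart q ∧ NCPart (interleave m p q) ∧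
  ∀ q', NCPart q' → NCPart (interleave m p q') → Refines q' q

/-- Two sets cross: there are `a < b < c < d` with `a, c ∈ B` and `b, d ∈ C`. -/
def Crossing {α : Type*} [LinearOrder α] (B C : Set α) : Prop :=
  ∃ a b c d : α, a < b ∧ b < c ∧ c < d ∧ a ∈ B ∧ c ∈ B ∧ b ∈ C ∧ d ∈ C

/-- Two members of a non-crossing family of pairwise disjoint sets: disjoint,
and neither crosses the other. -/
def PairNC {α : Type*} [LinearOrder α] (B C : Set α) : Prop :=
  Disjoint B C ∧ ¬ Crossing B C ∧ ¬ Crossing C B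

end NCPB
namespace NCPB

/-- The generating set `R_n` of the hyperoctahedral group: all transpositions `(i,-i)`
and all products `(i,j)(-i,-j)` with `|i| ≠ |j|`. -/
def Rn (n : ℕ) : Set (Equiv.Perm (Fin (2*n))) :=
  {ρ | (∃ i, ρ = Equiv.swap i (negMap n i)) ∨
       (∃ i j, absMap n i ≠ absMap n j ∧
          ρ = Equiv.swap i j * Equiv.swap (negMap n i) (negMap n j))}

/-- Membership in the hyperoctahedral group `W_n`: permutations of `[±n]` commuting
with the inversion map. -/
def InWn (n : ℕ) (τ : Equiv.Perm (Fin (2*n))) : Prop :=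
  ∀ k, τ (negMap n k) = negMap n (τ k)

/-- Word-length with respect to the generating set `R_n`. -/
noncomputable def lenB (n : ℕ) (τ : Equiv.Perm (Fin (2*n))) : ℕ :=
  sInf {k | ∃ l : List (Equiv.Perm (Fin (2*n))),
    (∀ ρ ∈ l, ρ ∈ Rn n) ∧ l.length = k ∧ l.prod = τ}

/-- The partial order on `W_n` coming from `(W_n, R_n)`: `a ≤ b` iff `|a| + |a⁻¹b| = |b|`. -/
def leB (n : ℕ) (a b : Equiv.Perm (Fin (2*n))) : Prop :=
  lenB n a + lenB n (a⁻¹ * b) = lenB n b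

/-- `b` covers `a` in the partial order coming from `(W_n, R_n)`. -/
def CoversB (n : ℕ) (a b : Equiv.Perm (Fin (2*n))) : Prop :=
  leB n a b ∧ lenB n b = lenB n a + 1

/-- The orbits of a permutation. -/
def orbitsOf (n : ℕ) (τ : Equiv.Perm (Fin (2*n))) : Set (Set (Fin (2*n))) :=
  {O | ∃ x, O = {y | τ.SameCycle x y}}

/-- Word-length with respect to the set of all transpositions of a symmetric group. -/
noncomputable def lenA (N : ℕ) (τ : Equiv.Perm (Fin N)) : ℕ :=
  sInf {k | ∃ l : List (Equiv.Perm (Fin N)),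
    (∀ ρ ∈ l, ρ.IsSwap) ∧ l.length = k ∧ l.prod = τ}

/-- The partial order on the symmetric group coming from all transpositions. -/
def leA (N : ℕ) (a b : Equiv.Perm (Fin N)) : Prop :=
  lenA N a + lenA N (a⁻¹ * b) = lenA N b

/-- `τ = ι(π)`: for each block `B` of `π` and `a ∈ B`, `τ a` is the cyclic successor of
`a` in `B` (the least element of `B` greater than `a`, or the least element of `B` if
`a` is the largest element of `B`). -/
def IsIota (N : ℕ) (π : Set (Set (Fin N))) (τ : Equiv.Perm (Fin N)) : Prop :=
  ∀ B ∈ π, ∀ a ∈ B,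
    ((∃ b ∈ B, a < b) → IsLeast {b | b ∈ B ∧ a < b} (τ a)) ∧
    ((∀ b ∈ B, ¬ a < b) → IsLeast B (τ a))

/-- The long inversion-invariant cycle `ω = (1, 2, ..., n, -1, -2, ..., -n)`. -/
def omegaW (n : ℕ) : Equiv.Perm (Fin (2*n)) := finRotate (2*n)

end NCPB
namespace NCPB

variable {n : ℕ}

lemma negMap_val (k : Fin (2*n)) :
    (negMap n k).val = if k.val < n then k.val + n else k.val - n := by
  have := k.isLt
  simp only [negMap]
  split_ifs with h
  · exact Nat.mod_eq_of_lt (by omega)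
  · rw [Nat.mod_eq_sub_mod (by omega), Nat.mod_eq_of_lt (by omega)]
    omega

lemma negMap_negMap (k : Fin (2*n)) : negMap n (negMap n k) = k := by
  have := k.isLt
  rw [Fin.ext_iff, negMap_val, negMap_val]
  split_ifs <;> omega

lemma negMap_ne (k : Fin (2*n)) : negMap n k ≠ k := by
  have := k.isLt
  rw [Ne, Fin.ext_iff, negMap_val]
  split_ifs <;> omega

lemma negMap_inj {j k : Fin (2*n)} : negMap n j = negMap n k ↔ j = k :=
  (Function.Involutive.injective negMap_negMap).eq_iff

lemma negMap_eq_comm {j k : Fin (2*n)} : negMap n j = k ↔ j = negMap n k := by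
  rw [← negMap_inj, negMap_negMap]

lemma absMap_eq_iff {j k : Fin (2*n)} : absMap n j = absMap n k ↔ j = k ∨ j = negMap n k := by
  have hj := j.isLt
  have hk := k.isLt
  have key : ∀ a : ℕ, a < 2 * n → a % n = if a < n then a else a - n := by
    intro a ha
    split_ifs with h
    · exact Nat.mod_eq_of_lt h
    · rw [Nat.mod_eq_sub_mod (by omega), Nat.mod_eq_of_lt (by omega)]
  rw [Fin.ext_iff, Fin.ext_iff, Fin.ext_iff, negMap_val]
  simp only [absMap, key _ hj, key _ hk]
  split_ifs <;> omega

lemma InWn.mul {a b : Equiv.Perm (Fin (2*n))} (ha : InWn n a) (hb : InWn n b) :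
    InWn n (a * b) := fun k => by
  rw [Equiv.Perm.mul_apply, Equiv.Perm.mul_apply, hb, ha]

lemma InWn.inv {a : Equiv.Perm (Fin (2*n))} (ha : InWn n a) : InWn n a⁻¹ := fun k => by
  rw [Equiv.Perm.inv_eq_iff_eq, ha, ← Equiv.Perm.mul_apply, mul_inv_cancel, Equiv.Perm.one_apply]

lemma inWn_one : InWn n 1 := fun _ => rfl

lemma inWn_omegaW : InWn n (omegaW n) := by
  rcases n with _ | m
  · exact fun k => k.elim0
  intro k
  have hk := k.isLt
  have h : ∀ j : Fin (2 * (m + 1)), (omegaW (m + 1) j).val = (j.val + 1) % (2 * (m + 1)) := by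
    intro j
    change (finRotate (2 * m + 1 + 1) j).val = _
    rw [finRotate_apply, Fin.val_add, Fin.val_one]
    rfl
  ext
  rw [h]
  simp only [negMap, h]
  rw [Nat.mod_add_mod, Nat.mod_add_mod]
  congr 1
  omega

lemma inWn_of_mem_Rn {ρ : Equiv.Perm (Fin (2*n))} (hρ : ρ ∈ Rn n) : InWn n ρ := by
  have hswap : ∀ i j k : Fin (2*n),
      negMap n (Equiv.swap i j k) = Equiv.swap (negMap n i) (negMap n j) (negMap n k) := fun i j k =>
    Function.Injective.map_swap (Function.Involutive.injective negMap_negMap) i j k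
  rcases hρ with ⟨i, rfl⟩ | ⟨i, j, hij, rfl⟩
  · intro k
    rw [hswap, negMap_negMap, Equiv.swap_comm]
  · rw [Ne, absMap_eq_iff, not_or] at hij
    obtain ⟨h1, h2⟩ := hij
    have h3 : negMap n i ≠ j := fun h => h2 (negMap_eq_comm.1 h)
    have h4 := mt negMap_inj.1 h1
    have h5 := negMap_ne i
    have h6 := negMap_ne j
    intro k
    rw [Equiv.Perm.mul_apply, Equiv.Perm.mul_apply, hswap, hswap, negMap_negMap, negMap_negMap]
    simp only [Equiv.swap_apply_def]
    grind

/-- The odd functions on `[±n]` that are invariant under `w`. -/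
def oddFixed (w : Equiv.Perm (Fin (2*n))) : Submodule ℚ (Fin (2*n) → ℚ) where
  carrier := {x | (∀ k, x (negMap n k) = - x k) ∧ ∀ k, x (w k) = x k}
  zero_mem' := by simp
  add_mem' := by
    rintro x y ⟨h1, h2⟩ ⟨h3, h4⟩
    exact ⟨fun k => by simp only [Pi.add_apply, h1, h3]; ring,
      fun k => by simp only [Pi.add_apply, h2, h4]⟩
  smul_mem' := by
    rintro c x ⟨h1, h2⟩
    exact ⟨fun k => by simp [h1], fun k => by simp [h2]⟩

lemma eq_of_sameCycle {w : Equiv.Perm (Fin (2*n))} {x : Fin (2*n) → ℚ} (hx : ∀ k, x (w k) = x k)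
    {i j : Fin (2*n)} (h : w.SameCycle i j) : x i = x j := by
  obtain ⟨k, rfl⟩ := h.exists_nat_pow_eq
  induction k with
  | zero => rfl
  | succ k ih =>
    rw [pow_succ', Equiv.Perm.mul_apply, hx]
    exact ih ⟨k, by simp⟩

lemma sameCycle_negMap {w : Equiv.Perm (Fin (2*n))} (hw : InWn n w) {i j : Fin (2*n)} :
    w.SameCycle (negMap n i) (negMap n j) ↔ w.SameCycle i j := by
  have key : ∀ i j, w.SameCycle i j → w.SameCycle (negMap n i) (negMap n j) := by
    intro i j h
    obtain ⟨k, rfl⟩ := h.exists_nat_pow_eq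
    refine ⟨k, ?_⟩
    rw [zpow_natCast]
    clear h
    induction k with
    | zero => rfl
    | succ k ih => rw [pow_succ', Equiv.Perm.mul_apply, Equiv.Perm.mul_apply, ih, hw]
  exact ⟨fun h => by simpa only [negMap_negMap] using key _ _ h, key i j⟩

/-- The indicator function of the orbit of `z` minus that of its negative. -/
noncomputable def oddIndicator (w : Equiv.Perm (Fin (2*n))) (z k : Fin (2*n)) : ℚ :=
  (if w.SameCycle z k then 1 else 0) - (if w.SameCycle z (negMap n k) then 1 else 0)

lemma oddIndicator_mem {w : Equiv.Perm (Fin (2*n))} (hw : InWn n w) (z : Fin (2*n)) :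
    oddIndicator w z ∈ oddFixed w := by
  refine ⟨fun k => ?_, fun k => ?_⟩
  · simp only [oddIndicator, negMap_negMap, neg_sub]
  · simp only [oddIndicator, ← hw k, Equiv.Perm.sameCycle_apply_right]

lemma sameCycle_negMap_iff {w : Equiv.Perm (Fin (2*n))} (hw : InWn n w) (z : Fin (2*n)) :
    w.SameCycle z (negMap n z) ↔ ∀ x ∈ oddFixed w, x z = 0 := by
  constructor
  · rintro h x ⟨h1, h2⟩
    have := eq_of_sameCycle h2 h
    rw [h1] at this
    linarith
  · intro h
    by_contra hz
    have := h _ (oddIndicator_mem hw z)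
    simp [oddIndicator, hz, Equiv.Perm.SameCycle.refl] at this

/-- At most one orbit of `w` is invariant under negation. -/
def ZeroOrbitUnique (w : Equiv.Perm (Fin (2*n))) : Prop :=
  ∀ y z, w.SameCycle y (negMap n y) → w.SameCycle z (negMap n z) → w.SameCycle y z

/-- Orbit containment from containment of the spaces of odd invariant functions. -/
lemma sameCycle_of_oddFixed_le {s t : Equiv.Perm (Fin (2*n))} (ht : InWn n t)
    (hle : oddFixed t ≤ oddFixed s) (hu : ZeroOrbitUnique t) {i j : Fin (2*n)}
    (h : s.SameCycle i j) : t.SameCycle i j := by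
  have key : ∀ i j, s.SameCycle i j → ¬ t.SameCycle i (negMap n i) → t.SameCycle i j := by
    intro i j h hi
    have := eq_of_sameCycle (hle (oddIndicator_mem ht i)).2 h
    by_contra hj
    simp only [oddIndicator, Equiv.Perm.SameCycle.refl, hi, hj, if_true, if_false] at this
    split_ifs at this <;> norm_num at this
  by_cases hi : t.SameCycle i (negMap n i)
  · by_cases hj : t.SameCycle j (negMap n j)
    · exact hu i j hi hj
    · exact (key j i h.symm hj).symm
  · exact key i j h hi

lemma apply_swap_of_eq {x : Fin (2*n) → ℚ} {a b : Fin (2*n)} (hab : x a = x b) (k : Fin (2*n)) :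
    x (Equiv.swap a b k) = x k := by
  rw [Equiv.swap_apply_def]
  split_ifs with h h
  · rw [h, hab]
  · rw [h, hab]
  · rfl

lemma exists_root_of_mem_Rn {ρ : Equiv.Perm (Fin (2*n))} (hρ : ρ ∈ Rn n) :
    ∃ i j : Fin (2*n),
      (∀ k, ρ k ≠ k → (k = i ∨ k = negMap n i) ∨ (k = j ∨ k = negMap n j)) ∧
      ∀ x : Fin (2*n) → ℚ, (∀ k, x (negMap n k) = - x k) → x i = x j → ∀ k, x (ρ k) = x k := by
  rcases hρ with ⟨i, rfl⟩ | ⟨i, j, hij, rfl⟩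
  · refine ⟨i, negMap n i, fun k hk => ?_, fun x _ hx k => ?_⟩
    · by_contra! h
      exact hk (Equiv.swap_apply_of_ne_of_ne h.1.1 h.1.2)
    · exact apply_swap_of_eq hx k
  · refine ⟨i, j, fun k hk => ?_, fun x ho hx k => ?_⟩
    · by_contra! h
      apply hk
      rw [Equiv.Perm.mul_apply, Equiv.swap_apply_of_ne_of_ne h.1.2 h.2.2,
        Equiv.swap_apply_of_ne_of_ne h.1.1 h.2.1]
    · have hx' : x (negMap n i) = x (negMap n j) := by rw [ho, ho, hx]
      rw [Equiv.Perm.mul_apply, apply_swap_of_eq hx, apply_swap_of_eq hx']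

lemma finrank_le_inf_ker_add_one {V : Type*} [AddCommGroup V] [Module ℚ V] [FiniteDimensional ℚ V]
    (F : Submodule ℚ V) (φ : V →ₗ[ℚ] ℚ) :
    Module.finrank ℚ F ≤ Module.finrank ℚ (F ⊓ LinearMap.ker φ : Submodule ℚ V) + 1 := by
  have h1 := Submodule.finrank_sup_add_finrank_inf_eq F (LinearMap.ker φ)
  have h2 := LinearMap.finrank_range_add_finrank_ker φ
  have h3 := Submodule.finrank_le (LinearMap.range φ)
  have h4 := Submodule.finrank_le (F ⊔ LinearMap.ker φ)
  rw [Module.finrank_self] at h3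
  omega

/-- Multiplying by a reflection lowers the dimension of `oddFixed` by at most one; if it does
lower it, the invariant space shrinks and uniqueness of the zero orbit is inherited. -/
lemma oddFixed_mul_reflection {w ρ : Equiv.Perm (Fin (2*n))} (hw : InWn n w) (hρ : ρ ∈ Rn n) :
    Module.finrank ℚ (oddFixed w) ≤ Module.finrank ℚ (oddFixed (w * ρ)) + 1 ∧
    (Module.finrank ℚ (oddFixed (w * ρ)) < Module.finrank ℚ (oddFixed w) →
      oddFixed (w * ρ) ≤ oddFixed w ∧ (ZeroOrbitUnique (w * ρ) → ZeroOrbitUnique w)) := by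
  obtain ⟨i, j, hmoved, hfix⟩ := exists_root_of_mem_Rn hρ
  let φ : (Fin (2*n) → ℚ) →ₗ[ℚ] ℚ :=
    LinearMap.proj (R := ℚ) (φ := fun _ => ℚ) i - LinearMap.proj (R := ℚ) (φ := fun _ => ℚ) j
  have hsub : oddFixed w ⊓ LinearMap.ker φ ≤ oddFixed (w * ρ) := by
    rintro x ⟨⟨ho, hx⟩, hφ⟩
    refine ⟨ho, fun k => ?_⟩
    rw [Equiv.Perm.mul_apply, hx]
    exact hfix x ho (sub_eq_zero.1 hφ) k
  have hdim := finrank_le_inf_ker_add_one (oddFixed w) φ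
  have hmono := Submodule.finrank_mono hsub
  refine ⟨by omega, fun hlt => ?_⟩
  have heq := Submodule.eq_of_le_of_finrank_le hsub (by omega)
  have hle : oddFixed (w * ρ) ≤ oddFixed w := heq ▸ inf_le_left
  refine ⟨hle, fun hu y z hy hz => ?_⟩
  have hwρ := hw.mul (inWn_of_mem_Rn hρ)
  have lift : ∀ z, w.SameCycle z (negMap n z) → (w * ρ).SameCycle z (negMap n z) := fun z h =>
    (sameCycle_negMap_iff hwρ z).2 fun x hx => (sameCycle_negMap_iff hw z).1 h x (hle hx)
  have hyz := hu y z (lift y hy) (lift z hz)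
  by_contra hne
  have hmeet : ∀ y z, (w * ρ).SameCycle y z → ¬ w.SameCycle y z →
      ∃ u, w.SameCycle y u ∧ ρ u ≠ u := by
    intro y z h h'
    by_contra! hall
    apply h'
    obtain ⟨k, rfl⟩ := h.exists_nat_pow_eq
    clear h h'
    induction k with
    | zero => exact Equiv.Perm.SameCycle.refl _ _
    | succ k ih =>
      rw [pow_succ', Equiv.Perm.mul_apply, Equiv.Perm.mul_apply, hall _ ih]
      exact Equiv.Perm.sameCycle_apply_right.2 ih
  obtain ⟨u, hyu, hu'⟩ := hmeet y z hyz hne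
  obtain ⟨v, hzv, hv'⟩ := hmeet z y hyz.symm fun h => hne h.symm
  have hzero : ∀ y u, w.SameCycle y (negMap n y) → w.SameCycle y u →
      w.SameCycle u (negMap n u) := fun y u h h' =>
    (h'.symm.trans h).trans ((sameCycle_negMap hw).2 h')
  have hu0 := hzero y u hy hyu
  have hv0 := hzero z v hz hzv
  have huv : ¬ w.SameCycle u v := fun h => hne ((hyu.trans h).trans hzv.symm)
  have hnotker : ¬ ∀ x ∈ oddFixed w, x i = 0 ∧ x j = 0 := by
    intro h
    have : oddFixed w ≤ oddFixed w ⊓ LinearMap.ker φ := fun x hx =>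
      ⟨hx, sub_eq_zero.2 ((h x hx).1.trans (h x hx).2.symm)⟩
    have := Submodule.finrank_mono (this.trans hsub)
    omega
  have hval : ∀ u i, w.SameCycle u (negMap n u) → (u = i ∨ u = negMap n i) →
      ∀ x ∈ oddFixed w, x i = 0 := by
    rintro u i h0 (rfl | rfl) x hx
    · exact (sameCycle_negMap_iff hw _).1 h0 x hx
    · have := (sameCycle_negMap_iff hw _).1 h0 x hx
      rwa [hx.1, neg_eq_zero] at this
  have hsame : ∀ i, (u = i ∨ u = negMap n i) → (v = i ∨ v = negMap n i) → False := by
    rintro i (h1 | h1) (h2 | h2)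
    · exact huv (h1 ▸ h2 ▸ Equiv.Perm.SameCycle.refl _ _)
    · exact huv (by rw [h2, ← h1]; exact hu0)
    · exact huv (by rw [h1, ← h2]; exact hv0.symm)
    · exact huv (h1 ▸ h2 ▸ Equiv.Perm.SameCycle.refl _ _)
  rcases hmoved u hu' with h1 | h1 <;> rcases hmoved v hv' with h2 | h2
  · exact hsame i h1 h2
  · exact hnotker fun x hx => ⟨hval u i hu0 h1 x hx, hval v j hv0 h2 x hx⟩
  · exact hnotker fun x hx => ⟨hval v i hv0 h2 x hx, hval u j hu0 h1 x hx⟩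
  · exact hsame j h1 h2

lemma oddFixed_mul_prod (l : List (Equiv.Perm (Fin (2*n)))) (hl : ∀ ρ ∈ l, ρ ∈ Rn n)
    {w : Equiv.Perm (Fin (2*n))} (hw : InWn n w) :
    Module.finrank ℚ (oddFixed w) ≤ Module.finrank ℚ (oddFixed (w * l.prod)) + l.length ∧
    (Module.finrank ℚ (oddFixed (w * l.prod)) + l.length ≤ Module.finrank ℚ (oddFixed w) →
      oddFixed (w * l.prod) ≤ oddFixed w ∧
        (ZeroOrbitUnique (w * l.prod) → ZeroOrbitUnique w)) := by
  induction l generalizing w with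
  | nil =>
    rw [List.prod_nil, mul_one]
    exact ⟨le_rfl, fun _ => ⟨le_rfl, id⟩⟩
  | cons ρ l ih =>
    have hρ := hl ρ List.mem_cons_self
    obtain ⟨h1, h2⟩ := oddFixed_mul_reflection hw hρ
    obtain ⟨h3, h4⟩ := ih (fun r hr => hl r (List.mem_cons_of_mem _ hr))
      (hw.mul (inWn_of_mem_Rn hρ))
    rw [List.prod_cons, ← mul_assoc, List.length_cons]
    refine ⟨by omega, fun h => ?_⟩
    obtain ⟨h5, h6⟩ := h2 (by omega)
    obtain ⟨h7, h8⟩ := h4 (by omega)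
    exact ⟨h7.trans h5, h6 ∘ h8⟩

/-- Every element of `W_n` is a product of at most half as many reflections as it has
non-fixed points. -/
lemma exists_word (w : Equiv.Perm (Fin (2*n))) (hw : InWn n w) :
    ∃ l : List (Equiv.Perm (Fin (2*n))),
      (∀ ρ ∈ l, ρ ∈ Rn n) ∧ l.prod = w ∧ 2 * l.length ≤ w.support.card := by
  induction h : w.support.card using Nat.strong_induction_on generalizing w with
  | _ c ih =>
  by_cases h1 : w = 1
  · exact ⟨[], by simp, by simp [h1], by simp⟩
  obtain ⟨i, hi⟩ : ∃ i, w i ≠ i := by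
    by_contra! hall
    exact h1 (Equiv.ext hall)
  have hne := negMap_ne i
  have hni : w (negMap n i) ≠ negMap n i := by
    rw [hw, Ne, negMap_inj]
    exact hi
  obtain ⟨ρ, hρ, hinv, hρi, hfix⟩ : ∃ ρ ∈ Rn n, ρ * ρ = 1 ∧ ρ (w i) = i ∧
      ∀ k, w k = k → ρ k = k := by
    by_cases hwi : absMap n i = absMap n (w i)
    · have hwi' : w i = negMap n i := by
        rcases absMap_eq_iff.1 hwi with h | h
        · exact absurd h.symm hi
        · exact (negMap_eq_comm.2 h).symm
      refine ⟨_, Or.inl ⟨i, rfl⟩, Equiv.swap_mul_self _ _, ?_, fun k hk => ?_⟩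
      · rw [hwi', Equiv.swap_apply_right]
      · exact Equiv.swap_apply_of_ne_of_ne (fun h => hi (h ▸ hk)) (fun h => hni (h ▸ hk))
    · have hmem : Equiv.swap i (w i) * Equiv.swap (negMap n i) (negMap n (w i)) ∈ Rn n :=
        Or.inr ⟨i, w i, hwi, rfl⟩
      rw [absMap_eq_iff, not_or] at hwi
      have hwi2 : w i ≠ negMap n i := fun h => hwi.2 (by rw [h, negMap_negMap])
      have hwi3 : w i ≠ negMap n (w i) := by
        rw [← hw]
        exact fun h => hne (w.injective h).symm
      refine ⟨_, hmem, ?_, ?_, fun k hk => ?_⟩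
      · ext k : 1
        simp only [Equiv.Perm.mul_apply, Equiv.Perm.one_apply, Equiv.swap_apply_def]
        have := @negMap_inj n i (w i)
        grind
      · rw [Equiv.Perm.mul_apply, Equiv.swap_apply_of_ne_of_ne hwi2 hwi3, Equiv.swap_apply_right]
      · have hk1 : k ≠ negMap n i := fun h => hni (h ▸ hk)
        have hk2 : k ≠ negMap n (w i) := by
          rw [← hw]
          rintro rfl
          exact hni (w.injective hk)
        have hk3 : k ≠ i := fun h => hi (h ▸ hk)
        have hk4 : k ≠ w i := by
          rintro rfl
          exact hi (w.injective hk)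
        rw [Equiv.Perm.mul_apply, Equiv.swap_apply_of_ne_of_ne hk1 hk2,
          Equiv.swap_apply_of_ne_of_ne hk3 hk4]
  have hρw := (inWn_of_mem_Rn hρ).mul hw
  have hρi' : (ρ * w) i = i := hρi
  have hsub : insert i (insert (negMap n i) (ρ * w).support) ⊆ w.support := by
    intro k hk
    rw [Finset.mem_insert, Finset.mem_insert] at hk
    rw [Equiv.Perm.mem_support]
    rcases hk with rfl | rfl | hk
    · exact hi
    · exact hni
    · intro hwk
      rw [Equiv.Perm.mem_support, Equiv.Perm.mul_apply, hwk] at hk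
      exact hk (hfix k hwk)
  have hcard := Finset.card_le_card hsub
  rw [Finset.card_insert_of_notMem, Finset.card_insert_of_notMem] at hcard
  rotate_left
  · rw [Equiv.Perm.mem_support, hρw, hρi']
    simp
  · rw [Finset.mem_insert, Equiv.Perm.mem_support, hρi']
    simpa using hne.symm
  obtain ⟨l, hl, hprod, hlen⟩ := ih _ (by omega) (ρ * w) hρw rfl
  refine ⟨ρ :: l, ?_, ?_, ?_⟩
  · intro r hr
    rcases List.mem_cons.1 hr with rfl | hr
    exacts [hρ, hl r hr]
  · rw [List.prod_cons, hprod, ← mul_assoc, hinv, one_mul]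
  · rw [List.length_cons]
    omega

lemma exists_reduced_word {w : Equiv.Perm (Fin (2*n))} (hw : InWn n w) :
    ∃ l : List (Equiv.Perm (Fin (2*n))),
      (∀ ρ ∈ l, ρ ∈ Rn n) ∧ l.length = lenB n w ∧ l.prod = w := by
  obtain ⟨l, h1, h2, -⟩ := exists_word w hw
  exact Nat.sInf_mem (s := {k | ∃ l : List (Equiv.Perm (Fin (2*n))),
    (∀ ρ ∈ l, ρ ∈ Rn n) ∧ l.length = k ∧ l.prod = w}) ⟨_, l, h1, rfl, h2⟩

lemma lenB_le {w : Equiv.Perm (Fin (2*n))} (hw : InWn n w) : lenB n w ≤ n := by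
  obtain ⟨l, h1, h2, h3⟩ := exists_word w hw
  have h4 : lenB n w ≤ l.length := Nat.sInf_le ⟨l, h1, rfl, h2⟩
  have h5 := Finset.card_le_univ w.support
  rw [Fintype.card_fin] at h5
  omega

lemma sameCycle_omegaW (hn : 0 < n) (x y : Fin (2*n)) : (omegaW n).SameCycle x y := by
  obtain ⟨m, hm⟩ : ∃ m, 2 * n = m + 2 := ⟨2 * n - 2, by omega⟩
  have hs : (omegaW n).support = Finset.univ := by
    unfold omegaW
    rw [hm]
    exact support_finRotate
  have hc : (omegaW n).IsCycle := by
    unfold omegaW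
    rw [hm]
    exact isCycle_finRotate
  have key : ∀ x, omegaW n x ≠ x := fun x => by
    rw [← Equiv.Perm.mem_support, hs]
    exact Finset.mem_univ x
  exact hc.sameCycle (key x) (key y)

lemma oddFixed_omegaW (hn : 0 < n) : oddFixed (omegaW n) = ⊥ := by
  rw [eq_bot_iff]
  rintro x hx
  ext k
  exact (sameCycle_negMap_iff inWn_omegaW k).1 (sameCycle_omegaW hn _ _) x hx

lemma le_finrank_oddFixed_one : n ≤ Module.finrank ℚ (oddFixed (1 : Equiv.Perm (Fin (2*n)))) := by
  let f : (Fin n → ℚ) →ₗ[ℚ] oddFixed (1 : Equiv.Perm (Fin (2*n))) :=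
    { toFun := fun x => ⟨fun k => if k.val < n then x (absMap n k) else - x (absMap n k), by
        refine ⟨fun k => ?_, fun k => rfl⟩
        have habs : absMap n (negMap n k) = absMap n k := absMap_eq_iff.2 (Or.inr rfl)
        have hk := k.isLt
        have hlt : (negMap n k).val < n ↔ ¬ k.val < n := by
          rw [negMap_val]
          split_ifs <;> omega
        simp only [habs, hlt]
        split_ifs <;> simp⟩
      map_add' := by
        intro x y
        ext k
        simp only [Submodule.coe_add, Pi.add_apply]
        split_ifs <;> ring
      map_smul' := by
        intro c x
        ext k
        simp only [Submodule.coe_smul, Pi.smul_apply, smul_eq_mul, RingHom.id_apply]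
        split_ifs <;> ring }
  have hf : Function.Injective f := by
    intro x y hxy
    ext i
    have hi := i.isLt
    have h := congrFun (congrArg Subtype.val hxy) ⟨i.val, by omega⟩
    have habs : absMap n ⟨i.val, by omega⟩ = i := Fin.ext (Nat.mod_eq_of_lt hi)
    simpa [f, habs] using h
  simpa using LinearMap.finrank_le_finrank_of_injective hf

end NCPB

open NCPB in
/-- If `σ ≤ τ ≤ ω` in the partial order coming from `(W_n, R_n)`,
then every orbit of `σ` is contained in an orbit of `τ`; in particular every fixed
point of `τ` is a fixed point of `σ`. -/
theorem orbits_subset_of_leB_le_omega (n : ℕ) (hn : 0 < n)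
    (σ τ : Equiv.Perm (Fin (2*n))) (hσ : InWn n σ) (hτ : InWn n τ)
    (h1 : leB n σ τ) (h2 : leB n τ (omegaW n)) :
    (∀ x y, σ.SameCycle x y → τ.SameCycle x y) ∧ (∀ x, τ x = x → σ x = x) := by
  obtain ⟨l₁, hl₁, hlen₁, hp₁⟩ := exists_reduced_word hσ
  obtain ⟨l₂, hl₂, hlen₂, hp₂⟩ := exists_reduced_word (hσ.inv.mul hτ)
  obtain ⟨l₃, hl₃, hlen₃, hp₃⟩ := exists_reduced_word (hτ.inv.mul inWn_omegaW)
  have hω := lenB_le (inWn_omegaW (n := n))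
  have hdω : Module.finrank ℚ (oddFixed (omegaW n)) = 0 := by
    rw [oddFixed_omegaW hn, finrank_bot]
  have hd1 := le_finrank_oddFixed_one (n := n)
  have hs₁ := (oddFixed_mul_prod l₁ hl₁ inWn_one).1
  have hs₂ := oddFixed_mul_prod l₂ hl₂ hσ
  have hs₃ := oddFixed_mul_prod l₃ hl₃ hτ
  rw [hp₁, one_mul] at hs₁
  rw [hp₂, mul_inv_cancel_left] at hs₂
  rw [hp₃, mul_inv_cancel_left] at hs₃
  unfold leB at h1 h2
  have hle : oddFixed τ ≤ oddFixed σ := (hs₂.2 (by omega)).1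
  have hu : ZeroOrbitUnique τ :=
    (hs₃.2 (by omega)).2 fun x y _ _ => sameCycle_omegaW hn x y
  have horb : ∀ x y, σ.SameCycle x y → τ.SameCycle x y :=
    fun x y h => sameCycle_of_oddFixed_le hτ hle hu h
  refine ⟨horb, fun x hx => ?_⟩
  have hxσ : τ.SameCycle x (σ x) :=
    horb _ _ (Equiv.Perm.sameCycle_apply_right.2 (Equiv.Perm.SameCycle.refl _ _))
  exact (hxσ.eq_of_left hx).symm
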